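/- Let γ be a drawing of a graph G, and let C₁,…,C_m be cycles of G, each crossing-free in γ, such that γ(C_{j+1}) is contained in the closed disk bounded by γ(C_j) for j = 1,…,m−1. Then for all indices i ≤ j ≤ l, every vertex of G lying on both C_i and C_l also lies on C_j; that is, V(C_i) ∩ V(C_l) ⊆ V(C_j). -/

import Mathlib

open Set Bornology

noncomputable section

namespace CrossingPaper

/-- Points of the plane. -/
abbrev Plane : Type := ℝ × ℝ

/-- A drawing of a (simple) graph `G` in the plane: each vertex is mapped to a point
(injectively), and each edge `e = uv` is mapped to an arc with ends `vmap u`, `vmap v`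
whose interior `emap e` avoids all vertex images; any two distinct edges intersect in
finitely many points. -/
structure Drawing {V : Type} (G : SimpleGraph V) where
  vmap : V → Plane
  emap : Sym2 V → Set Plane
  vmap_inj : Function.Injective vmap
  arc : ∀ e ∈ G.edgeSet, ∀ u v : V, e = s(u, v) →
    ∃ f : ℝ → Plane, ContinuousOn f (Icc 0 1) ∧ InjOn f (Icc 0 1) ∧
      f 0 = vmap u ∧ f 1 = vmap v ∧ emap e = f '' Ioo 0 1
  avoid : ∀ e ∈ G.edgeSet, ∀ v : V, vmap v ∉ emap e
  finite_inter : ∀ e ∈ G.edgeSet, ∀ e' ∈ G.edgeSet, e ≠ e' → (emap e ∩ emap e').Finite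

variable {V : Type} {G : SimpleGraph V}

/-- The set of crossings of a drawing: points lying on (the interiors of) two distinct
edges. -/
def Drawing.crossings (γ : Drawing G) : Set Plane :=
  {p | ∃ e ∈ G.edgeSet, ∃ e' ∈ G.edgeSet, e ≠ e' ∧ p ∈ γ.emap e ∧ p ∈ γ.emap e'}

/-- The crossing number of a graph: the minimum number of crossings over all drawings. -/
def crossingNumber (G : SimpleGraph V) : ℕ :=
  sInf {n | ∃ γ : Drawing G, γ.crossings.Finite ∧ γ.crossings.ncard = n}

/-- `G` is `k`-crossing-critical: `cr(G) ≥ k` and `cr(G - e) < k` for every edge `e`. -/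
def CrossingCritical (G : SimpleGraph V) (k : ℕ) : Prop :=
  k ≤ crossingNumber G ∧
    ∀ e ∈ G.edgeSet, crossingNumber (G.deleteEdges {e}) < k

/-- The image of a subgraph under a drawing. -/
def Drawing.image (γ : Drawing G) (H : G.Subgraph) : Set Plane :=
  γ.vmap '' H.verts ∪ ⋃ e ∈ H.edgeSet, γ.emap e

/-- The image of a whole drawing. -/
def Drawing.totalImage (γ : Drawing G) : Set Plane :=
  range γ.vmap ∪ ⋃ e ∈ G.edgeSet, γ.emap e

/-- The union of all bounded complementary components of a set in the plane: for a
Jordan curve this is the open disk bounded by the curve. -/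
def boundedSide (s : Set Plane) : Set Plane :=
  {p | p ∉ s ∧ IsBounded (connectedComponentIn sᶜ p)}

/-- For a Jordan curve, the closed disk bounded by the curve. -/
def closedRegion (s : Set Plane) : Set Plane :=
  s ∪ boundedSide s

/-- A subgraph is a cycle: connected, finite, and every vertex has exactly two
neighbours. -/
def IsCycleSubgraph (H : G.Subgraph) : Prop :=
  H.Connected ∧ H.verts.Finite ∧ ∀ v ∈ H.verts, (H.neighborSet v).ncard = 2

/-- A subgraph is crossing-free in a drawing if none of its edges is crossed by
another edge of `G`. -/
def Drawing.CrossingFree (γ : Drawing G) (H : G.Subgraph) : Prop :=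
  ∀ e ∈ H.edgeSet, ∀ e' ∈ G.edgeSet, e ≠ e' → γ.emap e ∩ γ.emap e' = ∅

/-- A sequence of cycles `C 0, …, C (t-1)` is a nest in `γ`: the cycles are pairwise
edge-disjoint, each is crossing-free in `γ`, and the image of each cycle is contained
in the closed disk bounded by the image of the previous one. -/
def Drawing.IsNest (γ : Drawing G) {t : ℕ} (C : Fin t → G.Subgraph) : Prop :=
  (∀ i, IsCycleSubgraph (C i)) ∧
  (∀ i j, i ≠ j → Disjoint (C i).edgeSet (C j).edgeSet) ∧
  (∀ i, γ.CrossingFree (C i)) ∧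
  (∀ i : ℕ, ∀ h : i + 1 < t,
    γ.image (C ⟨i + 1, h⟩) ⊆ closedRegion (γ.image (C ⟨i, by omega⟩)))

/-- An `s`-nest: a nest such that any two distinct cycles intersect exactly in a fixed
set `X` of `s` vertices. -/
def Drawing.IsSNest (γ : Drawing G) (s : ℕ) {t : ℕ} (C : Fin t → G.Subgraph) : Prop :=
  γ.IsNest C ∧ ∃ X : Set V, X.Finite ∧ X.ncard = s ∧
    ∀ i j, i ≠ j → (C i).verts ∩ (C j).verts = X

/-- A nest `C 0, …, C (t-1)` in `γ` is clean if every crossing of `γ` lies either in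
the open disk bounded by the image of the last cycle or outside the closed disk
bounded by the image of the first cycle. -/
def Drawing.IsCleanNest (γ : Drawing G) {t : ℕ} (C : Fin t → G.Subgraph) : Prop :=
  ∀ h : 0 < t, ∀ p ∈ γ.crossings,
    p ∈ boundedSide (γ.image (C ⟨t - 1, by omega⟩)) ∨
      p ∉ closedRegion (γ.image (C ⟨0, h⟩))

/-- A drawing is generic: no point lies on three distinct edges, and no two adjacent
edges cross. -/
def Drawing.Generic (γ : Drawing G) : Prop :=
  (∀ p : Plane, ∀ e₁ ∈ G.edgeSet, ∀ e₂ ∈ G.edgeSet, ∀ e₃ ∈ G.edgeSet,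
    p ∈ γ.emap e₁ → p ∈ γ.emap e₂ → p ∈ γ.emap e₃ → e₁ = e₂ ∨ e₁ = e₃ ∨ e₂ = e₃) ∧
  (∀ e ∈ G.edgeSet, ∀ e' ∈ G.edgeSet, e ≠ e' → (∃ v : V, v ∈ e ∧ v ∈ e') →
    γ.emap e ∩ γ.emap e' = ∅)

/-- The faces of a (crossing-free) drawing: the connected components of the complement
of its image. -/
def Drawing.faces (γ : Drawing G) : Set (Set Plane) :=
  {F | ∃ x, x ∉ γ.totalImage ∧ F = connectedComponentIn γ.totalImageᶜ x}

/-- The length of (the boundary of) a face: the number of edges of the graph drawn on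
its frontier. -/
def Drawing.faceLength (γ : Drawing G) (F : Set Plane) : ℕ :=
  {e | e ∈ G.edgeSet ∧ γ.emap e ⊆ frontier F}.ncard

/-- A drawing is a plane triangulation if it has no crossings and every face (including
the outer face) is bounded by a triangle of the graph. -/
def Drawing.IsPlaneTriangulation (γ : Drawing G) : Prop :=
  γ.crossings = ∅ ∧
  ∀ F ∈ γ.faces, ∃ T : G.Subgraph, IsCycleSubgraph T ∧ T.verts.ncard = 3 ∧
    frontier F = γ.image T


/-- Continuous logarithms exist on simply connected spaces. -/
theorem exists_log {X : Type} [TopologicalSpace X] [SimplyConnectedSpace X]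
    [LocallyPathConnectedSpace X] (F : X → ℂ) (hF : Continuous F) (h0 : ∀ x, F x ≠ 0) :
    ∃ L : X → ℂ, Continuous L ∧ ∀ x, Complex.exp (L x) = F x := by
  obtain ⟨a⟩ : Nonempty X := inferInstance
  obtain ⟨L, hL, -⟩ := Complex.isCoveringMap_exp.existsUnique_continuousMap_lifts
    (⟨fun x => ⟨F x, h0 x⟩, by fun_prop⟩ : C(X, {z : ℂ // z ≠ 0})) a (Complex.log (F a))
    (by simp [Complex.exp_log (h0 a)])
  refine ⟨L, L.continuous, fun x => ?_⟩
  have := congrFun hL.2 x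
  exact congrArg Subtype.val this

/-- Every nonvanishing continuous function on `A` has a continuous logarithm. -/
def HasLog (A : Set Plane) : Prop :=
  ∀ φ : Plane → ℂ, ContinuousOn φ A → (∀ x ∈ A, φ x ≠ 0) →
    ∃ g : Plane → ℂ, ContinuousOn g A ∧ ∀ x ∈ A, Complex.exp (g x) = φ x

theorem hasLog_singleton (p : Plane) : HasLog {p} := by
  intro φ _ h0
  refine ⟨fun _ => Complex.log (φ p), continuousOn_const, ?_⟩
  rintro x rfl
  exact Complex.exp_log (h0 x rfl)

theorem hasLog_arc {f : ℝ → Plane} {a b : ℝ} (hab : a ≤ b) (hc : ContinuousOn f (Icc a b))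
    (hi : InjOn f (Icc a b)) : HasLog (f '' Icc a b) := by
  intro φ hφ h0
  have hcomp : ContinuousOn (fun t => φ (f t)) (Icc a b) :=
    hφ.comp hc (mapsTo_image f _)
  obtain ⟨L, hL, hexp⟩ := exists_log (fun t : ℝ => φ (f (projIcc a b hab t)))
    (by
      have h1 : Continuous (fun t : Icc a b => φ (f t)) := hcomp.domRestrict
      exact h1.comp continuous_projIcc)
    (fun t => h0 _ (mem_image_of_mem f (projIcc a b hab t).2))
  refine ⟨fun x => L (Function.invFunOn f (Icc a b) x), ?_, ?_⟩
  · let r : Icc a b → Plane := fun t => f t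
    have hr : Continuous r := hc.domRestrict
    have hrinj : Function.Injective r := fun s t h => Subtype.ext (hi s.2 t.2 h)
    have hemb := hr.isClosedEmbedding hrinj
    have : ContinuousOn (Function.invFunOn f (Icc a b)) (f '' Icc a b) := by
      rw [continuousOn_iff_isClosed]
      intro t ht
      refine ⟨r '' (Subtype.val ⁻¹' t), hemb.isClosedMap _ (ht.preimage continuous_subtype_val), ?_⟩
      ext x
      constructor
      · rintro ⟨hx, s, hs, rfl⟩
        refine ⟨⟨⟨s, hs⟩, ?_, rfl⟩, ⟨s, hs, rfl⟩⟩
        simpa [hi.leftInvOn_invFunOn hs] using hx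
      · rintro ⟨⟨s, hs, rfl⟩, hx⟩
        refine ⟨?_, hx⟩
        change Function.invFunOn f (Icc a b) (f s) ∈ t
        rw [hi.leftInvOn_invFunOn s.2]
        exact hs
    exact hL.comp_continuousOn this
  · rintro x ⟨s, hs, rfl⟩
    change Complex.exp (L (Function.invFunOn f (Icc a b) (f s))) = _
    rw [hi.leftInvOn_invFunOn hs, hexp, projIcc_of_mem hab hs]

theorem hasLog_union {A B : Set Plane} (hA : IsClosed A) (hB : IsClosed B) (hLA : HasLog A)
    (hLB : HasLog B) {q : Plane} (hqA : q ∈ A) (hqB : q ∈ B) (hAB : ∀ x ∈ A, x ∈ B → x = q) :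
    HasLog (A ∪ B) := by
  classical
  intro φ hφ h0
  obtain ⟨g, hg, hge⟩ := hLA φ (hφ.mono subset_union_left) (fun x hx => h0 x (Or.inl hx))
  obtain ⟨k, hk, hke⟩ := hLB φ (hφ.mono subset_union_right) (fun x hx => h0 x (Or.inr hx))
  have hB' : ∀ x ∈ B, (if x ∈ A then g x else k x + (g q - k q)) = k x + (g q - k q) := by
    intro x hx
    by_cases hxA : x ∈ A
    · obtain rfl := hAB x hxA hx
      simp [hqA]
    · simp [hxA]
  refine ⟨fun x => if x ∈ A then g x else k x + (g q - k q), ?_, ?_⟩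
  · refine ContinuousOn.union_of_isClosed ?_ ?_ hA hB
    · exact hg.congr (fun x hx => by simp [hx])
    · exact (hk.add continuousOn_const).congr hB'
  · rintro x (hx | hx)
    · simp [hx, hge]
    · simp only [hB' x hx]
      rw [Complex.exp_add, Complex.exp_sub, hke x hx, hge q hqA, hke q hqB,
        div_self (h0 q (Or.inl hqA)), mul_one]

theorem frontier_component {A : Set Plane} (hA : IsClosed A) (p : Plane) :
    frontier (connectedComponentIn Aᶜ p) ⊆ A := by
  intro x hx
  by_contra hxA
  have hop : IsOpen (connectedComponentIn Aᶜ p) := hA.isOpen_compl.connectedComponentIn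
  have hopx : IsOpen (connectedComponentIn Aᶜ x) := hA.isOpen_compl.connectedComponentIn
  rw [hop.frontier_eq] at hx
  have hxx : x ∈ connectedComponentIn Aᶜ x := mem_connectedComponentIn hxA
  obtain ⟨y, hy1, hy2⟩ := mem_closure_iff.1 hx.1 _ hopx hxx
  apply hx.2
  rw [connectedComponentIn_eq hy2, ← connectedComponentIn_eq hy1]
  exact hxx

/-- A compact set with the logarithm property does not separate the plane: no component of its
complement is bounded. -/
theorem unbounded_of_hasLog {A : Set Plane} (hA : IsCompact A) (hL : HasLog A) {p : Plane}
    (hp : p ∉ A) : ¬ IsBounded (connectedComponentIn Aᶜ p) := by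
  classical
  intro hbd
  set U := connectedComponentIn Aᶜ p with hU
  let ι : ℂ ≃L[ℝ] Plane := Complex.equivRealProdCLM
  have hpU : p ∈ U := mem_connectedComponentIn hp
  obtain ⟨g, hg, hge⟩ := hL (fun x => ι.symm (x - p)) (by fun_prop) (by
    intro x hx h
    have : x - p = 0 := (map_eq_zero_iff ι.symm ι.symm.injective).1 h
    exact hp (sub_eq_zero.1 this ▸ hx))
  obtain ⟨k, hk⟩ := ContinuousMap.exists_restrict_eq hA.isClosed
    (⟨A.domRestrict g, hg.domRestrict⟩ : C(A, ℂ))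
  have hk' : ∀ x ∈ A, k x = g x := fun x hx =>
    DFunLike.congr_fun hk ⟨x, hx⟩
  let h : Plane → ℂ := fun x => if x ∈ U then Complex.exp (k x) else ι.symm (x - p)
  have hh : Continuous h := by
    refine Continuous.if ?_ (by fun_prop) (by fun_prop)
    intro x hx
    have hxA : x ∈ A := frontier_component hA.isClosed p hx
    rw [hk' x hxA, hge x hxA]
  have hh0 : ∀ x, h x ≠ 0 := by
    intro x
    by_cases hx : x ∈ U
    · simp only [h, hx, if_true]; exact Complex.exp_ne_zero _
    · simp only [h, hx, if_false]
      intro h'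
      have : x - p = 0 := (map_eq_zero_iff ι.symm ι.symm.injective).1 h'
      exact hx (sub_eq_zero.1 this ▸ hpU)
  obtain ⟨L, hLc, hLe⟩ := exists_log h hh hh0
  obtain ⟨M, hM⟩ := hbd.exists_norm_le
  -- choose a large radius
  have hcomp : ∃ R : ℝ, 0 < R ∧ ∀ x ∈ U, ‖ι.symm (x - p)‖ < R := by
    refine ⟨‖(ι.symm : Plane →L[ℝ] ℂ)‖ * (M + ‖p‖) + 1, ?_, ?_⟩
    · have : 0 ≤ M := (norm_nonneg p).trans (hM p hpU)
      positivity
    · intro x hx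
      have h1 := (ι.symm : Plane →L[ℝ] ℂ).le_opNorm (x - p)
      have h2 : ‖x - p‖ ≤ M + ‖p‖ := (norm_sub_le _ _).trans (by linarith [hM x hx])
      have h3 := mul_le_mul_of_nonneg_left h2 (norm_nonneg (ι.symm : Plane →L[ℝ] ℂ))
      simp only [ContinuousLinearEquiv.coe_coe] at h1
      linarith
  obtain ⟨R, hR, hRU⟩ := hcomp
  let z : ℝ → ℂ := fun θ => R * Complex.exp (θ * Complex.I)
  have hz : ∀ θ, Complex.exp (L (p + ι (z θ))) = z θ := by
    intro θ
    rw [hLe]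
    have : p + ι (z θ) ∉ U := by
      intro hx
      have := hRU _ hx
      simp [z, Complex.norm_exp_ofReal_mul_I, abs_of_pos hR] at this
    simp [h, this]
  have hzc : Continuous z := by fun_prop
  have hconst := Complex.isCoveringMap_exp.const_of_comp
    (g := fun θ : ℝ => L (p + ι (z θ)) - θ * Complex.I) (by fun_prop) (by
      have : ∀ θ : ℝ, Complex.exp (L (p + ι (z θ)) - θ * Complex.I) = R := by
        intro θ
        rw [Complex.exp_sub, hz]
        simp [z]
      intro a a'
      apply Subtype.ext
      simp only [this]) 0 (2 * Real.pi)
  have hzz : z (2 * Real.pi) = z 0 := by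
    simp [z, Complex.exp_two_pi_mul_I]
  simp only [hzz, Complex.ofReal_zero, zero_mul, sub_zero] at hconst
  have : ((2 * Real.pi : ℝ) : ℂ) * Complex.I = 0 := by
    linear_combination hconst
  simp [Real.pi_ne_zero] at this

/-! ### Regions -/

theorem mem_compl_closedRegion {s : Set Plane} {p : Plane} :
    p ∉ closedRegion s ↔ p ∉ s ∧ ¬ IsBounded (connectedComponentIn sᶜ p) := by
  simp only [closedRegion, boundedSide, mem_union, mem_ofPred_eq]
  tauto

theorem component_subset_compl_closedRegion {s : Set Plane} {p : Plane}
    (hp : p ∉ closedRegion s) : connectedComponentIn sᶜ p ⊆ (closedRegion s)ᶜ := by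
  intro x hx
  rw [mem_compl_closedRegion] at hp
  rw [mem_compl_iff, mem_compl_closedRegion, ← connectedComponentIn_eq hx]
  exact ⟨connectedComponentIn_subset _ _ hx, hp.2⟩

theorem isOpen_compl_closedRegion {s : Set Plane} (hs : IsClosed s) :
    IsOpen (closedRegion s)ᶜ := by
  rw [isOpen_iff_forall_mem_open]
  intro x hx
  exact ⟨_, component_subset_compl_closedRegion hx, hs.isOpen_compl.connectedComponentIn,
    mem_connectedComponentIn (mem_compl_closedRegion.1 hx).1⟩

theorem isOpen_boundedSide {s : Set Plane} (hs : IsClosed s) : IsOpen (boundedSide s) := by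
  rw [isOpen_iff_forall_mem_open]
  rintro x ⟨hx, hb⟩
  refine ⟨connectedComponentIn sᶜ x, ?_, hs.isOpen_compl.connectedComponentIn,
    mem_connectedComponentIn hx⟩
  intro y hy
  refine ⟨connectedComponentIn_subset _ _ hy, ?_⟩
  rwa [← connectedComponentIn_eq hy]

theorem closedRegion_mono {s t : Set Plane} (h : t ⊆ closedRegion s) :
    closedRegion t ⊆ closedRegion s := by
  intro p hp
  by_contra hps
  have hsub := component_subset_compl_closedRegion hps
  rw [mem_compl_closedRegion] at hps
  have hpc : p ∈ connectedComponentIn sᶜ p := mem_connectedComponentIn hps.1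
  have hsub' : connectedComponentIn sᶜ p ⊆ connectedComponentIn tᶜ p :=
    isPreconnected_connectedComponentIn.subset_connectedComponentIn hpc
      (fun x hx hxt => hsub hx (h hxt))
  have hpt : p ∉ t := fun hpt => hsub hpc (h hpt)
  exact mem_compl_closedRegion.2 ⟨hpt, fun hb => hps.2 (hb.subset hsub')⟩ hp

/-- Points far away are outside the closed region. -/
theorem far_outside {s : Set Plane} {R : ℝ} (hR : ∀ x ∈ s, ‖x‖ ≤ R) (h0 : 0 ≤ R) {x : Plane}
    (hx : R < ‖x‖) : x ∉ closedRegion s := by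
  have hsub : ∀ t : ℝ, 1 ≤ t → t • x ∈ sᶜ := by
    intro t ht hts
    have := hR _ hts
    rw [norm_smul, Real.norm_eq_abs, abs_of_nonneg (by linarith)] at this
    nlinarith
  rw [mem_compl_closedRegion]
  refine ⟨by simpa using hsub 1 le_rfl, fun hb => ?_⟩
  have hray : (fun t : ℝ => t • x) '' Ici 1 ⊆ connectedComponentIn sᶜ x := by
    refine IsPreconnected.subset_connectedComponentIn ?_ ⟨1, self_mem_Ici, by simp⟩ ?_
    · exact isPreconnected_Ici.image _ (by fun_prop)
    · rintro _ ⟨t, ht, rfl⟩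
      exact hsub t ht
  obtain ⟨M, hM⟩ := (hb.subset hray).exists_norm_le
  have hxpos : 0 < ‖x‖ := h0.trans_lt hx
  have hM0 := hM _ ⟨1 + |M| / ‖x‖, by simp; positivity, rfl⟩
  simp only [norm_smul, Real.norm_eq_abs] at hM0
  rw [abs_of_nonneg (by positivity), add_mul, div_mul_cancel₀ _ hxpos.ne'] at hM0
  linarith [le_abs_self M]

/-! ### Drawings of paths and cycles -/

theorem cycle_walk {C : G.Subgraph} (hC : IsCycleSubgraph C) {v : V} (hv : v ∈ C.verts) :
    ∃ u, ∃ _ : G.Adj v u, ∃ q : G.Walk u v, q.IsPath ∧ s(v, u) ∉ q.edges ∧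
      C.verts = {x | x ∈ q.support} ∧ C.edgeSet = {e | e = s(v, u) ∨ e ∈ q.edges} := by
  classical
  obtain ⟨hconn, hfin, hdeg⟩ := hC
  have : Finite C.verts := hfin
  have := Fintype.ofFinite C.verts
  have hdeg' : ∀ x : C.verts, (C.coe.neighborSet x).ncard = 2 := by
    intro x
    rw [← hdeg x x.2, ← Set.ncard_image_of_injective _ Subtype.val_injective]
    congr 1
    ext y
    constructor
    · rintro ⟨y, hy, rfl⟩
      exact hy
    · intro hy
      exact ⟨⟨y, C.edge_vert (C.adj_symm hy)⟩, hy, rfl⟩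
  have hcyc : C.coe.IsCycles := fun x _ => hdeg' x
  have hne : (C.coe.neighborSet ⟨v, hv⟩).Nonempty :=
    Set.nonempty_of_ncard_ne_zero (by rw [hdeg']; norm_num)
  obtain ⟨p, hp, hpv⟩ := hcyc.exists_cycle_toSubgraph_verts_eq_connectedComponentSupp
    (c := C.coe.connectedComponentMk ⟨v, hv⟩) (by simp) hne
  have hall : ∀ x : C.verts, x ∈ p.support := by
    intro x
    rw [← SimpleGraph.Walk.mem_verts_toSubgraph, hpv]
    simp only [SimpleGraph.ConnectedComponent.mem_supp_iff, SimpleGraph.ConnectedComponent.eq]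
    exact hconn.coe.preconnected x ⟨v, hv⟩
  have hadj : ∀ x y : C.verts, C.Adj x y → s(x, y) ∈ p.edges := by
    intro x y hxy
    rw [← SimpleGraph.Walk.mem_edges_toSubgraph, SimpleGraph.Subgraph.mem_edgeSet,
      hp.adj_toSubgraph_iff_of_isCycles hcyc (by simpa using hall x)]
    exact hxy
  have hp' : (p.map C.hom).IsCycle := hp.map SimpleGraph.Subgraph.hom_injective
  have hall' : ∀ x ∈ C.verts, x ∈ (p.map C.hom).support := by
    intro x hx
    rw [SimpleGraph.Walk.support_map, List.mem_map]
    exact ⟨⟨x, hx⟩, hall _, rfl⟩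
  have hsup : ∀ x ∈ (p.map C.hom).support, x ∈ C.verts := by
    intro x hx
    rw [SimpleGraph.Walk.support_map, List.mem_map] at hx
    obtain ⟨y, -, rfl⟩ := hx
    exact y.2
  have hedge : ∀ e, e ∈ C.edgeSet ↔ e ∈ (p.map C.hom).edges := by
    intro e
    rw [SimpleGraph.Walk.edges_map, List.mem_map]
    constructor
    · induction e with | _ x y =>
      intro h
      have h' : C.Adj x y := h
      exact ⟨s(⟨x, C.edge_vert h'⟩, ⟨y, C.edge_vert h'.symm⟩), hadj _ _ h', rfl⟩
    · rintro ⟨e, he, rfl⟩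
      have := p.edges_subset_edgeSet he
      induction e with | _ x y => exact this
  obtain ⟨r, hp', hall', hsup, hedge⟩ : ∃ r : G.Walk v v, r.IsCycle ∧
      (∀ x ∈ C.verts, x ∈ r.support) ∧ (∀ x ∈ r.support, x ∈ C.verts) ∧
      ∀ e, e ∈ C.edgeSet ↔ e ∈ r.edges :=
    ⟨p.map C.hom, hp', hall', hsup, hedge⟩
  cases r with
  | nil => exact absurd hp' (by simp)
  | cons h q =>
    rw [SimpleGraph.Walk.cons_isCycle_iff] at hp'
    refine ⟨_, h, q, hp'.1, hp'.2, ?_, ?_⟩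
    · ext x
      constructor
      · intro hx
        have := hall' x hx
        rw [SimpleGraph.Walk.support_cons, List.mem_cons] at this
        rcases this with rfl | h
        · exact q.end_mem_support
        · exact h
      · intro hx
        exact hsup x (by rw [SimpleGraph.Walk.support_cons]; exact List.mem_cons_of_mem _ hx)
    · ext e
      rw [hedge, SimpleGraph.Walk.edges_cons, List.mem_cons]
      rfl

/-- The image of a walk. -/
def walkImage (γ : Drawing G) {u v : V} (q : G.Walk u v) : Set Plane :=
  γ.vmap '' {x | x ∈ q.support} ∪ ⋃ e ∈ {e | e ∈ q.edges}, γ.emap e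

theorem arc_decomp (f : ℝ → Plane) : f '' Icc 0 1 = {f 0} ∪ f '' Ioo 0 1 ∪ {f 1} := by
  rw [← image_singleton (f := f) (a := 0), ← image_singleton (f := f) (a := 1), ← image_union, ← image_union]
  congr 1
  rw [singleton_union, Ioo_insert_left zero_lt_one, union_singleton, Ico_insert_right zero_le_one]

theorem glue_arc (γ : Drawing G) {u w v : V} (hadj : G.Adj u w) (q : G.Walk w v)
    (hcomp : IsCompact (walkImage γ q)) (hlog : HasLog (walkImage γ q))
    (hnot : s(u, w) ∉ q.edges)
    (hcf : ∀ e' ∈ G.edgeSet, s(u, w) ≠ e' → γ.emap s(u, w) ∩ γ.emap e' = ∅)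
    {f : ℝ → Plane} (hc : ContinuousOn f (Icc 0 1)) (hi : InjOn f (Icc 0 1))
    (hf0 : f 0 = γ.vmap u) (hf1 : f 1 = γ.vmap w) (hfe : γ.emap s(u, w) = f '' Ioo 0 1)
    {a : ℝ} (ha0 : 0 ≤ a) (ha1 : a ≤ 1) (ha : 0 < a ∨ u ∉ q.support) :
    IsCompact (f '' Icc a 1 ∪ walkImage γ q) ∧ HasLog (f '' Icc a 1 ∪ walkImage γ q) := by
  have hsub : Icc a 1 ⊆ Icc 0 1 := Icc_subset_Icc_left ha0
  have hcA : IsCompact (f '' Icc a 1) := isCompact_Icc.image_of_continuousOn (hc.mono hsub)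
  refine ⟨hcA.union hcomp, hasLog_union hcA.isClosed hcomp.isClosed
    (hasLog_arc ha1 (hc.mono hsub) (hi.mono hsub)) hlog (q := γ.vmap w)
    ⟨1, right_mem_Icc.2 ha1, hf1⟩ (Or.inl ⟨w, q.start_mem_support, rfl⟩) ?_⟩
  rintro _ ⟨t, ht, rfl⟩ hx
  rcases eq_or_lt_of_le ht.2 with rfl | ht1
  · exact hf1
  exfalso
  have hedge : ∀ e ∈ q.edges, e ∈ G.edgeSet := fun e he => q.edges_subset_edgeSet he
  rcases eq_or_lt_of_le (ha0.trans ht.1) with rfl | ht0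
  · rcases ha with ha | ha
    · exact absurd ht.1 (not_le.2 ha)
    · rw [hf0] at hx
      rcases hx with ⟨y, hy, hyu⟩ | hx
      · exact ha (γ.vmap_inj hyu ▸ hy)
      · simp only [mem_iUnion] at hx
        obtain ⟨e, he, hx⟩ := hx
        exact γ.avoid e (hedge e he) u hx
  · have hmem : f t ∈ γ.emap s(u, w) := hfe ▸ mem_image_of_mem f ⟨ht0, ht1⟩
    rcases hx with ⟨y, hy, hyu⟩ | hx
    · exact γ.avoid _ hadj y (hyu ▸ hmem)
    · simp only [mem_iUnion] at hx
      obtain ⟨e, he, hx⟩ := hx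
      have : f t ∈ γ.emap s(u, w) ∩ γ.emap e := ⟨hmem, hx⟩
      rw [hcf e (hedge e he) (fun h => hnot (h ▸ he))] at this
      exact this

theorem walkImage_cons (γ : Drawing G) {u w v : V} (hadj : G.Adj u w) (q : G.Walk w v)
    {f : ℝ → Plane}
    (hf0 : f 0 = γ.vmap u) (hf1 : f 1 = γ.vmap w) (hfe : γ.emap s(u, w) = f '' Ioo 0 1) :
    walkImage γ (SimpleGraph.Walk.cons hadj q) = f '' Icc 0 1 ∪ walkImage γ q := by
  have hw : γ.vmap w ∈ γ.vmap '' {x | x ∈ q.support} := ⟨w, q.start_mem_support, rfl⟩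
  rw [arc_decomp, ← hfe, hf0, hf1]
  ext x
  simp only [walkImage, SimpleGraph.Walk.support_cons, SimpleGraph.Walk.edges_cons, List.mem_cons,
    mem_union, mem_iUnion, mem_image, mem_ofPred_eq, mem_singleton_iff] at hw ⊢
  constructor
  · rintro (⟨y, rfl | hy, rfl⟩ | ⟨e, rfl | he, hx⟩)
    · simp
    · exact Or.inr (Or.inl ⟨y, hy, rfl⟩)
    · exact Or.inl (Or.inl (Or.inr hx))
    · exact Or.inr (Or.inr ⟨e, he, hx⟩)
  · rintro (((rfl | hx) | rfl) | ⟨y, hy, rfl⟩ | ⟨e, he, hx⟩)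
    · exact Or.inl ⟨u, Or.inl rfl, rfl⟩
    · exact Or.inr ⟨_, Or.inl rfl, hx⟩
    · exact Or.inl ⟨w, Or.inr q.start_mem_support, rfl⟩
    · exact Or.inl ⟨y, Or.inr hy, rfl⟩
    · exact Or.inr ⟨e, Or.inr he, hx⟩

theorem walkImage_path (γ : Drawing G) {u v : V} (q : G.Walk u v) (hq : q.IsPath)
    (hcf : ∀ e ∈ q.edges, ∀ e' ∈ G.edgeSet, e ≠ e' → γ.emap e ∩ γ.emap e' = ∅) :
    IsCompact (walkImage γ q) ∧ HasLog (walkImage γ q) := by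
  induction q with
  | nil =>
    rename_i u
    have : walkImage γ (SimpleGraph.Walk.nil : G.Walk u u) = {γ.vmap u} := by
      simp [walkImage]
    rw [this]
    exact ⟨isCompact_singleton, hasLog_singleton _⟩
  | cons hadj q ih =>
    rename_i u w v
    rw [SimpleGraph.Walk.cons_isPath_iff] at hq
    obtain ⟨h1, h2⟩ := ih hq.1 (fun e he => hcf e (by
      rw [SimpleGraph.Walk.edges_cons]; exact List.mem_cons_of_mem _ he))
    obtain ⟨f, hc, hi, hf0, hf1, hfe⟩ := γ.arc s(u, w) hadj u w rfl
    rw [walkImage_cons γ hadj q hf0 hf1 hfe]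
    exact glue_arc γ hadj q h1 h2
      (fun h => hq.2 (q.fst_mem_support_of_mem_edges h))
      (hcf _ (by rw [SimpleGraph.Walk.edges_cons]; exact List.mem_cons_self))
      hc hi hf0 hf1 hfe le_rfl zero_le_one (Or.inr hq.2)

/-- The image of a crossing-free cycle is compact, and each of its vertices is in the closure of
the exterior. -/
theorem cycle_vertex (γ : Drawing G) {C : G.Subgraph} (hC : IsCycleSubgraph C)
    (hcf : γ.CrossingFree C) {v : V} (hv : v ∈ C.verts) :
    IsCompact (γ.image C) ∧ γ.vmap v ∈ closure (closedRegion (γ.image C))ᶜ := by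
  obtain ⟨u, hadj, q, hq, hnot, hverts, hedges⟩ := cycle_walk hC hv
  obtain ⟨f, hc, hi, hf0, hf1, hfe⟩ := γ.arc s(v, u) hadj v u rfl
  have hvq : v ∈ q.support := q.end_mem_support
  have himg : γ.image C = f '' Icc 0 1 ∪ walkImage γ q := by
    rw [← walkImage_cons γ hadj q hf0 hf1 hfe, Drawing.image, walkImage, hverts, hedges]
    congr 1
    · congr 1
      ext x
      simp only [mem_ofPred_eq, SimpleGraph.Walk.support_cons, List.mem_cons]
      constructor
      · exact Or.inr
      · rintro (rfl | h)
        exacts [hvq, h]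
    · simp [SimpleGraph.Walk.edges_cons]
  have hcfq : ∀ e ∈ q.edges, ∀ e' ∈ G.edgeSet, e ≠ e' → γ.emap e ∩ γ.emap e' = ∅ :=
    fun e he => hcf e (by rw [hedges]; exact Or.inr he)
  obtain ⟨hqc, hql⟩ := walkImage_path γ q hq hcfq
  have hJ : IsCompact (γ.image C) := by
    rw [himg]; exact (isCompact_Icc.image_of_continuousOn hc).union hqc
  refine ⟨hJ, ?_⟩
  by_contra hcl
  obtain ⟨O, hO, hvO, hOE⟩ : ∃ O : Set Plane, IsOpen O ∧ γ.vmap v ∈ O ∧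
      O ∩ (closedRegion (γ.image C))ᶜ = ∅ :=
    ⟨(closure (closedRegion (γ.image C))ᶜ)ᶜ, isClosed_closure.isOpen_compl, hcl, by
      rw [← disjoint_iff_inter_eq_empty]
      exact disjoint_compl_left.mono_right subset_closure⟩
  -- a small initial segment of the arc lies in `O`
  obtain ⟨δ, hδ0, hδ1, hδ⟩ : ∃ δ : ℝ, 0 < δ ∧ δ ≤ 1 ∧ ∀ t ∈ Ico 0 δ, f t ∈ O := by
    have h0 : ContinuousWithinAt f (Icc 0 1) 0 := hc 0 (by simp)
    have hev : f ⁻¹' O ∈ nhdsWithin (0 : ℝ) (Icc 0 1) :=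
      h0 (hO.mem_nhds (by rw [hf0]; exact hvO))
    rw [Metric.mem_nhdsWithin_iff] at hev
    obtain ⟨ε, hε, hsub⟩ := hev
    refine ⟨min ε 1, by positivity, min_le_right _ _, fun t ht => ?_⟩
    have h1 : t < ε := ht.2.trans_le (min_le_left _ _)
    have h2 : t < 1 := ht.2.trans_le (min_le_right _ _)
    exact hsub ⟨by simp [abs_of_nonneg ht.1, h1], ht.1, h2.le⟩
  obtain ⟨hAc, hAl⟩ := glue_arc γ hadj q hqc hql hnot
    (hcf _ (by rw [hedges]; exact Or.inl rfl)) hc hi hf0 hf1 hfe hδ0.le hδ1 (Or.inl hδ0)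
  set A := f '' Icc δ 1 ∪ walkImage γ q with hAdef
  have hJA : γ.image C \ A ⊆ O := by
    rintro x ⟨hx, hxA⟩
    rw [himg] at hx
    rcases hx with ⟨t, ht, rfl⟩ | hx
    · by_cases htδ : t < δ
      · exact hδ t ⟨ht.1, htδ⟩
      · exact absurd (Or.inl ⟨t, ⟨not_lt.1 htδ, ht.2⟩, rfl⟩) hxA
    · exact absurd (Or.inr hx) hxA
  have hAJ : A ⊆ γ.image C := by
    rw [himg]
    exact union_subset_union_left _ (image_mono (Icc_subset_Icc_left hδ0.le))
  have hδ2 : δ / 2 ∈ Ioo (0 : ℝ) 1 := ⟨by linarith, by linarith⟩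
  -- the midpoint of the removed segment
  have hm : f (δ / 2) ∉ A := by
    rintro (⟨t, ht, hte⟩ | hx)
    · have := hi ⟨hδ0.le.trans ht.1, ht.2⟩ ⟨hδ2.1.le, hδ2.2.le⟩ hte
      linarith [ht.1]
    · have hmem : f (δ / 2) ∈ γ.emap s(v, u) := hfe ▸ mem_image_of_mem f hδ2
      rcases hx with ⟨y, hy, hyu⟩ | hx
      · exact γ.avoid _ hadj y (hyu ▸ hmem)
      · simp only [mem_iUnion] at hx
        obtain ⟨e, he, hx⟩ := hx
        have h3 : f (δ / 2) ∈ γ.emap s(v, u) ∩ γ.emap e := ⟨hmem, hx⟩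
        rw [hcf s(v, u) (by rw [hedges]; exact Or.inl rfl) e (q.edges_subset_edgeSet he)
          (fun h => hnot (h ▸ he))] at h3
        exact h3
  have hunb := unbounded_of_hasLog hAc hAl hm
  apply hunb
  obtain ⟨R, hR⟩ := hJ.isBounded.exists_norm_le
  rw [isBounded_iff_forall_norm_le]
  refine ⟨max R 0, fun x hx => ?_⟩
  by_contra hxR
  have hxE : x ∈ (closedRegion (γ.image C))ᶜ :=
    far_outside (fun y hy => (hR y hy).trans (le_max_left R 0)) (le_max_right _ _) (not_le.1 hxR)
  have hmO : f (δ / 2) ∈ O := hδ _ ⟨hδ2.1.le, by linarith⟩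
  have hpre : IsPreconnected (connectedComponentIn Aᶜ (f (δ / 2))) :=
    isPreconnected_connectedComponentIn
  obtain ⟨y, -, hy1, hy2⟩ := hpre _ (boundedSide (γ.image C) ∪ O)
    (isOpen_compl_closedRegion hJ.isClosed)
    ((isOpen_boundedSide hJ.isClosed).union hO) (by
      intro y hy
      have hyA : y ∉ A := connectedComponentIn_subset _ _ hy
      by_cases hyE : y ∈ closedRegion (γ.image C)
      · rcases hyE with hyJ | hyb
        · exact Or.inr (Or.inr (hJA ⟨hyJ, hyA⟩))
        · exact Or.inr (Or.inl hyb)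
      · exact Or.inl hyE)
    ⟨x, hx, hxE⟩ ⟨_, mem_connectedComponentIn hm, Or.inr hmO⟩
  rcases hy2 with hy2 | hy2
  · exact hy1 (Or.inr hy2)
  · have : y ∈ O ∩ (closedRegion (γ.image C))ᶜ := ⟨hy2, hy1⟩
    rw [hOE] at this
    exact this

/-- **the nesting property, from the proof of Theorem 2.** Let `γ` be a
drawing of a graph `G` and let `C₁, …, C_m` be crossing-free cycles of `G` such that
`γ(C_{j+1})` is contained in the closed disk bounded by `γ(C_j)` for each `j`. Then
for all indices `i ≤ j ≤ l`, every vertex lying on both `C_i` and `C_l` also lies on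
`C_j`. -/
theorem statement10 {V : Type} {G : SimpleGraph V} (γ : Drawing G) (m : ℕ)
    (C : Fin m → G.Subgraph)
    (hcyc : ∀ i, IsCycleSubgraph (C i))
    (hcf : ∀ i, γ.CrossingFree (C i))
    (hnested : ∀ i : ℕ, ∀ h : i + 1 < m,
      γ.image (C ⟨i + 1, h⟩) ⊆ closedRegion (γ.image (C ⟨i, by omega⟩))) :
    ∀ i j l : Fin m, i ≤ j → j ≤ l →
      (C i).verts ∩ (C l).verts ⊆ (C j).verts := by
  have hmono : ∀ a : ℕ, ∀ b : ℕ, ∀ ha : a < m, ∀ hb : b < m, a ≤ b →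
      γ.image (C ⟨b, hb⟩) ⊆ closedRegion (γ.image (C ⟨a, ha⟩)) := by
    intro a b ha hb hab
    induction b, hab using Nat.le_induction with
    | base => exact subset_union_left
    | succ n hn ih =>
      exact (hnested n hb).trans (closedRegion_mono (ih (by omega)))
  rintro ⟨i, hi⟩ ⟨j, hj⟩ ⟨l, hl⟩ hij hjl v ⟨hvi, hvl⟩
  by_contra hvj
  obtain ⟨w, hw⟩ := (hcyc ⟨j, hj⟩).1.nonempty
  have hJc := (cycle_vertex γ (hcyc ⟨j, hj⟩) (hcf _) hw).1
  obtain ⟨-, hcl⟩ := cycle_vertex γ (hcyc ⟨i, hi⟩) (hcf _) hvi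
  have hvJ : γ.vmap v ∉ γ.image (C ⟨j, hj⟩) := by
    rintro (⟨y, hy, hyv⟩ | hx)
    · exact hvj (γ.vmap_inj hyv ▸ hy)
    · simp only [mem_iUnion] at hx
      obtain ⟨e, he, hx⟩ := hx
      exact γ.avoid e ((C ⟨j, hj⟩).edgeSet_subset he) v hx
  have hvb : γ.vmap v ∈ boundedSide (γ.image (C ⟨j, hj⟩)) :=
    (hmono j l hj hl hjl (Or.inl ⟨v, hvl, rfl⟩)).resolve_left hvJ
  obtain ⟨x, hxb, hxE⟩ := mem_closure_iff.1 hcl _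
    (isOpen_boundedSide hJc.isClosed) hvb
  exact hxE (closedRegion_mono (hmono i j hi hj hij) (Or.inr hxb))

end CrossingPaper
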